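/- Let p, q ∈ ℤ² with q ∧ p ≠ 0, let α ≥ 0, and assume q is of type I₀ relative to p, i.e. ‖q‖ < ‖p‖ and ‖q + n·p‖ > ‖p‖ for every integer n ≠ 0. Suppose λ > 0 and w : ℤ → ℝ is a square-summable sequence, not identically zero, satisfying ρ_{n−1} w_{n−1} − ρ_{n+1} w_{n+1} = λ w_n for all n ∈ ℤ and satisfying the sign pattern I₀. Then there exist constants C > 0 and δ > 0 such that |w_n| ≤ C·e^{−δ|n|} for all n ∈ ℤ; in particular (w_n) belongs to the weighted space ℓ²_s(ℤ) for every s ≥ 0. -/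

import Mathlib

open Filter Topology

/-- Euclidean norm of a point of the integer lattice `ℤ²`. -/
noncomputable def znorm (v : ℤ × ℤ) : ℝ := Real.sqrt ((v.1 : ℝ) ^ 2 + (v.2 : ℝ) ^ 2)

/-- The wedge product `q ∧ p = q₁p₂ − q₂p₁`. -/
def wedge (q p : ℤ × ℤ) : ℤ := q.1 * p.2 - q.2 * p.1

/-- The coefficients `ρ_n` of the linearized α-Euler operator `L_{B,q}`. -/
noncomputable def rho (p q : ℤ × ℤ) (α : ℝ) (n : ℤ) : ℝ :=
  1 - (znorm p ^ 2 * (1 + α ^ 2 * znorm p ^ 2)) /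
      (znorm (q + n • p) ^ 2 * (1 + α ^ 2 * znorm (q + n • p) ^ 2))

/-- Sign pattern `I₀` (one of the two branches): `w_n > 0` for `n ≥ 1`, `w₀ < 0`,
`w_{−1} < 0`, and `(−1)^{|n|} w_n > 0` for `n ≤ −2`. -/
def SignI0aux (w : ℤ → ℝ) : Prop :=
  (∀ n : ℤ, 1 ≤ n → 0 < w n) ∧ w 0 < 0 ∧ w (-1) < 0 ∧
    ∀ n : ℤ, n ≤ -2 → 0 < (-1 : ℝ) ^ n.natAbs * w n

/-- A sequence satisfies the sign pattern `I₀` if either it or its negative satisfies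
the inequalities of `SignI0aux`. -/
def SignI0 (w : ℤ → ℝ) : Prop := SignI0aux w ∨ SignI0aux (fun n => -w n)

/-- A positive number `r < 1` solving the characteristic equation `r² + lam r = 1`. -/
lemma exists_characteristic_root {lam : ℝ} (hlam : 0 < lam) :
    ∃ r : ℝ, 0 < r ∧ r < 1 ∧ r * (lam + r) = 1 := by
  have hs : √(lam ^ 2 + 4) ^ 2 = lam ^ 2 + 4 := Real.sq_sqrt (by positivity)
  have h0 : 0 ≤ √(lam ^ 2 + 4) := Real.sqrt_nonneg _
  refine ⟨(√(lam ^ 2 + 4) - lam) / 2, ?_, ?_, by linarith⟩ <;> nlinarith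

/-- A nonnegative solution of the one-sided recurrence decays geometrically. -/
lemma geometric_decay_of_recurrence {lam r : ℝ} (hlam : 0 < lam) (hr0 : 0 < r)
    (hr : r * (lam + r) = 1) {a u : ℕ → ℝ} (ha : ∀ k, 0 ≤ a k) (hau : ∀ k, a k ≤ u k)
    (hrec : ∀ k, a k - a (k + 2) = lam * u (k + 1)) :
    ∃ C : ℝ, ∀ k, |u (k + 1)| ≤ C * r ^ k := by
  have hb : ∀ k, a k + r * a (k + 1) ≤ (a 0 + r * a 1) * r ^ k := by
    intro k
    induction k with
    | zero => simp
    | succ k ih =>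
      have h1 : a (k + 2) + lam * a (k + 1) ≤ a k := by
        have := hrec k
        have := mul_le_mul_of_nonneg_left (hau (k + 1)) hlam.le
        linarith
      calc a (k + 1) + r * a (k + 1 + 1)
          = r * ((lam + r) * a (k + 1) + a (k + 2)) := by linear_combination -a (k + 1) * hr
        _ ≤ r * (a k + r * a (k + 1)) := mul_le_mul_of_nonneg_left (by linarith) hr0.le
        _ ≤ r * ((a 0 + r * a 1) * r ^ k) := by gcongr
        _ = _ := by ring
  refine ⟨(a 0 + r * a 1) / lam, fun k => ?_⟩
  rw [abs_of_nonneg ((ha _).trans (hau _)), div_mul_eq_mul_div, le_div_iff₀ hlam]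
  have h1 := hb k
  have h2 := hrec k
  have h3 := ha (k + 2)
  have h4 := mul_nonneg hr0.le (ha (k + 1))
  linarith

lemma geometric_bound_of_shift {r : ℝ} (hr0 : 0 < r) (m : ℕ) {f : ℕ → ℝ} {C : ℝ}
    (h : ∀ k, |f (k + m)| ≤ C * r ^ k) : ∃ C' : ℝ, ∀ k, |f k| ≤ C' * r ^ k := by
  induction m generalizing C with
  | zero => exact ⟨C, h⟩
  | succ m ih =>
    refine ih (C := max |f m| (C / r)) fun k => ?_
    cases k with
    | zero => simp
    | succ k =>
      calc |f (k + 1 + m)| ≤ C * r ^ k := by simpa [add_assoc, add_comm 1 m] using h k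
        _ = C / r * r ^ (k + 1) := by field_simp; ring
        _ ≤ _ := by gcongr; exact le_max_right _ _

lemma znorm_nonneg (v : ℤ × ℤ) : 0 ≤ znorm v := Real.sqrt_nonneg _

/-- The coefficient `ρ_n` lies in `[0, 1]` when `q + n p` is longer than `p`. -/
lemma rho_mem_Icc {p q : ℤ × ℤ} (α : ℝ) {n : ℤ} (h : znorm p < znorm (q + n • p)) :
    rho p q α n ∈ Set.Icc (0 : ℝ) 1 := by
  have hp := znorm_nonneg p
  have hx : 0 < znorm (q + n • p) := hp.trans_lt h
  unfold rho
  refine ⟨sub_nonneg.2 ?_, sub_le_self _ (by positivity)⟩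
  rw [div_le_one (by positivity)]
  gcongr

/-- Exponential decay for one branch of the sign pattern. -/
lemma exponential_decay_of_signI0aux {p q : ℤ × ℤ} {α lam : ℝ}
    (hn : ∀ n : ℤ, n ≠ 0 → znorm p < znorm (q + n • p)) (hlam : 0 < lam) {w : ℤ → ℝ}
    (hrec : ∀ n : ℤ, rho p q α (n - 1) * w (n - 1) - rho p q α (n + 1) * w (n + 1)
      = lam * w n)
    (hsign : SignI0aux w) :
    ∃ C : ℝ, 0 < C ∧ ∃ δ : ℝ, 0 < δ ∧ ∀ n : ℤ, |w n| ≤ C * Real.exp (-δ * |(n : ℝ)|) := by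
  obtain ⟨hpos, -, -, hneg⟩ := hsign
  obtain ⟨r, hr0, hr1, hr⟩ := exists_characteristic_root hlam
  have hrho : ∀ n : ℤ, n ≠ 0 → rho p q α n ∈ Set.Icc (0 : ℝ) 1 := fun n h =>
    rho_mem_Icc α (hn n h)
  have hright : ∃ C : ℝ, ∀ k : ℕ, |w k| ≤ C * r ^ k := by
    have hw : ∀ k : ℕ, 0 ≤ w (k + 1) := fun k => (hpos _ (by lia)).le
    have hρ : ∀ k : ℕ, rho p q α (k + 1) ∈ Set.Icc (0 : ℝ) 1 := fun k => hrho _ (by lia)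
    obtain ⟨C, hC⟩ := geometric_decay_of_recurrence (a := fun k => rho p q α (k + 1) * w (k + 1))
      (u := fun k => w (k + 1)) hlam hr0 hr
      (fun k => mul_nonneg (hρ k).1 (hw k))
      (fun k => mul_le_of_le_one_left (hw k) (hρ k).2)
      (fun k => by
        have := hrec (k + 2)
        rw [show (k : ℤ) + 2 - 1 = k + 1 by ring] at this
        push_cast
        rw [show (k : ℤ) + 1 + 1 = k + 2 by ring]
        exact this)
    refine geometric_bound_of_shift (f := fun k : ℕ => w k) hr0 2 (C := C) fun k => ?_
    have := hC k
    push_cast at this ⊢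
    rwa [show (k : ℤ) + 1 + 1 = k + 2 by ring] at this
  have hleft : ∃ C : ℝ, ∀ k : ℕ, |w (-k)| ≤ C * r ^ k := by
    have hw : ∀ k : ℕ, 0 ≤ (-1) ^ k * w (-(k + 2)) := fun k => by
      have := (hneg (-(k + 2)) (by lia)).le
      rw [show (-((k : ℤ) + 2)).natAbs = k + 2 by lia] at this
      simpa [pow_add] using this
    have hρ : ∀ k : ℕ, rho p q α (-(k + 2)) ∈ Set.Icc (0 : ℝ) 1 := fun k => hrho _ (by lia)
    obtain ⟨C, hC⟩ := geometric_decay_of_recurrence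
      (a := fun k => rho p q α (-(k + 2)) * ((-1) ^ k * w (-(k + 2))))
      (u := fun k => (-1) ^ k * w (-(k + 2))) hlam hr0 hr
      (fun k => mul_nonneg (hρ k).1 (hw k))
      (fun k => mul_le_of_le_one_left (hw k) (hρ k).2)
      (fun k => by
        have := hrec (-(k + 3))
        rw [show -((k : ℤ) + 3) - 1 = -(k + 2 + 2) by ring,
          show -((k : ℤ) + 3) + 1 = -(k + 2) by ring] at this
        push_cast
        rw [show (k : ℤ) + 1 + 2 = k + 3 by ring]
        linear_combination -(-1) ^ k * this)
    refine geometric_bound_of_shift (f := fun k : ℕ => w (-k)) hr0 3 (C := C) fun k => ?_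
    have := hC k
    rw [abs_mul, abs_pow, abs_neg, abs_one, one_pow, one_mul] at this
    push_cast at this ⊢
    rwa [show (k : ℤ) + 1 + 2 = k + 3 by ring] at this
  obtain ⟨C₁, h₁⟩ := hright
  obtain ⟨C₂, h₂⟩ := hleft
  refine ⟨max 1 (max C₁ C₂), by positivity, -Real.log r, by
    simpa using Real.log_neg hr0 hr1, fun n => ?_⟩
  have hexp : ∀ k : ℕ, Real.exp (- -Real.log r * (k : ℝ)) = r ^ k := fun k => by
    rw [neg_neg, mul_comm, Real.exp_nat_mul, Real.exp_log hr0]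
  obtain ⟨k, rfl | rfl⟩ := n.eq_nat_or_neg
  · simp only [Int.cast_natCast, Nat.abs_cast, hexp]
    exact (h₁ k).trans (by gcongr; simp)
  · simp only [Int.cast_neg, abs_neg, Int.cast_natCast, Nat.abs_cast, hexp]
    exact (h₂ k).trans (by gcongr; simp)

/-- An exponentially decaying sequence on `ℤ` is square-summable with polynomial weights. -/
lemma summable_weight_mul_sq_of_exponential_decay {w : ℤ → ℝ} {C δ : ℝ} (hδ : 0 < δ)
    (h : ∀ n : ℤ, |w n| ≤ C * Real.exp (-δ * |(n : ℝ)|)) (s : ℝ) :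
    Summable (fun n : ℤ => (1 + |(n : ℝ)| ^ (2 * s)) * (w n) ^ 2) := by
  obtain ⟨K, hK⟩ := exists_nat_ge (2 * s)
  have hnat : ∀ m : ℕ, Summable fun k : ℕ => (k : ℝ) ^ m * Real.exp (-(2 * δ) * k) :=
    fun m => Real.summable_pow_mul_exp_neg_nat_mul m (by positivity)
  have hint : Summable fun n : ℤ =>
      C ^ 2 * (2 * (|(n : ℝ)| ^ 0 * Real.exp (-(2 * δ) * |(n : ℝ)|)) +
        |(n : ℝ)| ^ K * Real.exp (-(2 * δ) * |(n : ℝ)|)) := by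
    have hz : ∀ m : ℕ, Summable fun n : ℤ =>
        |(n : ℝ)| ^ m * Real.exp (-(2 * δ) * |(n : ℝ)|) := fun m =>
      Summable.of_nat_of_neg (by simpa using hnat m) (by simpa using hnat m)
    exact (((hz 0).mul_left 2).add (hz K)).mul_left _
  refine Summable.of_nonneg_of_le (fun n => by positivity) (fun n => ?_) hint
  have hsq : (w n) ^ 2 ≤ C ^ 2 * Real.exp (-(2 * δ) * |(n : ℝ)|) := by
    rw [← sq_abs, show -(2 * δ) * |(n : ℝ)| = (2 : ℕ) * (-δ * |(n : ℝ)|) by push_cast; ring,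
      Real.exp_nat_mul, ← mul_pow]
    gcongr
    exact h n
  have hpow : |(n : ℝ)| ^ (2 * s) ≤ 1 + |(n : ℝ)| ^ K := by
    rcases eq_or_ne n 0 with rfl | hn0
    · have := Real.zero_rpow_le_one (2 * s)
      have : (0 : ℝ) ≤ |((0 : ℤ) : ℝ)| ^ K := by positivity
      rw [Int.cast_zero, abs_zero] at this ⊢
      linarith
    · have h1 : (1 : ℝ) ≤ |(n : ℝ)| := by exact_mod_cast Int.one_le_abs hn0
      have := Real.rpow_le_rpow_of_exponent_le h1 hK
      rw [Real.rpow_natCast] at this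
      linarith
  calc (1 + |(n : ℝ)| ^ (2 * s)) * (w n) ^ 2
      ≤ (1 + (1 + |(n : ℝ)| ^ K)) * (C ^ 2 * Real.exp (-(2 * δ) * |(n : ℝ)|)) := by gcongr
    _ = _ := by ring

/-- For `q` of type `I₀`, any eigenvector of `L_{B,q}` with positive eigenvalue and
sign pattern `I₀` decays exponentially; in particular it lies in every weighted
space `ℓ²_s(ℤ)`, `s ≥ 0`. -/
theorem eigenvector_exponential_decay_typeI0
    (p q : ℤ × ℤ) (hwedge : wedge q p ≠ 0) (α : ℝ) (hα : 0 ≤ α)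
    (hq : znorm q < znorm p)
    (hn : ∀ n : ℤ, n ≠ 0 → znorm p < znorm (q + n • p))
    (lam : ℝ) (hlam : 0 < lam) (w : ℤ → ℝ)
    (hsum : Summable (fun n : ℤ => (w n) ^ 2)) (hw : w ≠ 0)
    (hrec : ∀ n : ℤ, rho p q α (n - 1) * w (n - 1) - rho p q α (n + 1) * w (n + 1)
      = lam * w n)
    (hsign : SignI0 w) :
    (∃ C : ℝ, 0 < C ∧ ∃ δ : ℝ, 0 < δ ∧
        ∀ n : ℤ, |w n| ≤ C * Real.exp (-δ * |(n : ℝ)|)) ∧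
      ∀ s : ℝ, 0 ≤ s →
        Summable (fun n : ℤ => (1 + |(n : ℝ)| ^ (2 * s)) * (w n) ^ 2) := by
  have hdecay : ∃ C : ℝ, 0 < C ∧ ∃ δ : ℝ, 0 < δ ∧
      ∀ n : ℤ, |w n| ≤ C * Real.exp (-δ * |(n : ℝ)|) := by
    rcases hsign with h | h
    · exact exponential_decay_of_signI0aux hn hlam hrec h
    · simpa using exponential_decay_of_signI0aux (w := fun n => -w n) hn hlam
        (fun n => by linear_combination -hrec n) h
  obtain ⟨C, hC, δ, hδ, h⟩ := hdecay
  exact ⟨⟨C, hC, δ, hδ, h⟩, fun s _ => summable_weight_mul_sq_of_exponential_decay hδ h s⟩
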